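/- Let B be the open unit ball of ℓ∞ (the Banach space of bounded complex sequences with the sup norm) centered at 0, and let T : B → ℓ∞ be analytic. Suppose |T(β) − β|_{ℓ∞} < ε for all β ∈ B. Then for every α ∈ ℓ∞ with |α|_{ℓ∞} < (1 − 4ε)/3 there exists a unique β* ∈ ℓ∞ with |β*|_{ℓ∞} < (1 − ε)/3 and T(β*) = α; moreover β* depends analytically on α. Furthermore, if 𝒰 is an open subset of a complex Banach space and T = T_u is analytically parametrized by u ∈ 𝒰 (i.e. each value T_u(β)_j is analytic in u and β), then β* also depends analytically on u. -/

import Mathlib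

/-!
Statement 9 (Lemma ℓ∞-Picard): an analytic map `T` of the open unit ball of `ℓ∞`
uniformly close to the identity admits a unique, analytically varying, local inverse.
-/

noncomputable section

/-- The Banach space `ℓ∞` of bounded complex sequences with the sup norm. -/
abbrev Linf : Type := lp (fun _ : ℕ => ℂ) ⊤

/-- Coordinatewise analyticity of a family `b : ℂ → ℓ∞` on `Ω`. -/
def CoordAnalytic (Ω : Set ℂ) (b : ℂ → Linf) : Prop :=
  ∀ j : ℕ, AnalyticOnNhd ℂ (fun τ => b τ j) Ω

/-- `T : U → ℓ∞` is analytic: along any family in `U` whose coordinates are analytic,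
the coordinates of the output are analytic. -/
def SeqAnalyticOn (U : Set Linf) (T : Linf → Linf) : Prop :=
  ∀ (Ω : Set ℂ), IsOpen Ω → ∀ b : ℂ → Linf,
    (∀ τ ∈ Ω, b τ ∈ U) → CoordAnalytic Ω b →
    ∀ j : ℕ, AnalyticOnNhd ℂ (fun τ => T (b τ) j) Ω

/-- Schwarz-lemma contraction estimate. -/
theorem linf_contract (ε : ℝ) (S : Linf → Linf) (hε : 4 * ε < 1)
    (hS : SeqAnalyticOn (Metric.ball 0 1) S)
    (hc : ∀ β ∈ Metric.ball (0 : Linf) 1, ‖S β - β‖ < ε)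
    (x y : Linf) (hx : ‖x‖ < (1 - ε) / 3) (hy : ‖y‖ < (1 - ε) / 3) :
    ‖(S y - y) - (S x - x)‖ ≤ (6 * ε / (2 + ε)) * ‖y - x‖ := by
  have hε0 : 0 < ε := lt_of_le_of_lt (norm_nonneg _) (hc 0 (by simp))
  by_cases hxy : y = x
  · subst hxy; simp
  have hd : 0 < ‖y - x‖ := norm_pos_iff.mpr (sub_ne_zero.mpr hxy)
  have hd2 : ‖y - x‖ < 2 * ((1 - ε) / 3) := by
    have := norm_sub_le y x
    linarith
  set R : ℝ := (2 + ε) / 3 / ‖y - x‖ with hR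
  have hR1 : 1 < R := by
    rw [hR, lt_div_iff₀ hd]; linarith
  have hmem : ∀ τ ∈ Metric.ball (0 : ℂ) R, x + τ • (y - x) ∈ Metric.ball (0 : Linf) 1 := by
    intro τ hτ
    rw [mem_ball_zero_iff] at hτ ⊢
    have h1 := norm_add_le x (τ • (y - x))
    rw [norm_smul] at h1
    have h2 : ‖τ‖ * ‖y - x‖ < (2 + ε) / 3 := by
      rwa [hR, lt_div_iff₀ hd] at hτ
    linarith
  refine lp.norm_le_of_forall_le (by positivity) fun j => ?_
  have hb : CoordAnalytic (Metric.ball (0 : ℂ) R) (fun τ => x + τ • (y - x)) := by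
    intro k
    refine DifferentiableOn.analyticOnNhd ?_ Metric.isOpen_ball
    have : (fun τ : ℂ => (x + τ • (y - x) : Linf) k) = fun τ : ℂ => x k + τ * (y k - x k) := by
      funext τ; rfl
    rw [this]
    fun_prop
  have han := hS _ Metric.isOpen_ball _ hmem hb j
  set f : ℂ → ℂ := fun τ => S (x + τ • (y - x)) j - (x + τ • (y - x) : Linf) j with hf
  have hfd : DifferentiableOn ℂ f (Metric.ball 0 R) :=
    han.differentiableOn.sub (hb j).differentiableOn
  have hfb : ∀ τ ∈ Metric.ball (0 : ℂ) R, ‖f τ‖ < ε := by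
    intro τ hτ
    refine lt_of_le_of_lt ?_ (hc _ (hmem τ hτ))
    exact lp.norm_apply_le_norm (by simp) (S (x + τ • (y - x)) - (x + τ • (y - x))) j
  have hmaps : Set.MapsTo f (Metric.ball 0 R) (Metric.ball (f 0) (2 * ε)) := by
    intro τ hτ
    rw [mem_ball_iff_norm]
    have h1 := hfb τ hτ
    have h2 := hfb 0 (by simp; linarith)
    have := norm_sub_le (f τ) (f 0)
    linarith
  have hsch := Complex.dist_le_div_mul_dist_of_mapsTo_ball hfd (hmaps.mono_right Metric.ball_subset_closedBall)
    (z := 1) (by simpa using hR1)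
  have e1 : f 1 = (S y - y) j := by
    have h : x + (1 : ℂ) • (y - x) = y := by rw [one_smul]; abel
    simp only [hf, h]
    rfl
  have e0 : f 0 = (S x - x) j := by
    have h : x + (0 : ℂ) • (y - x) = x := by rw [zero_smul, add_zero]
    simp only [hf, h]
    rfl
  rw [dist_eq_norm, e1, e0] at hsch
  refine le_trans hsch (le_of_eq ?_)
  simp only [dist_zero_right, norm_one, hR]
  field_simp
  norm_num

theorem linf_sol (ε : ℝ) (S : Linf → Linf)
    (hS : SeqAnalyticOn (Metric.ball 0 1) S)
    (hc : ∀ β ∈ Metric.ball (0 : Linf) 1, ‖S β - β‖ < ε)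
    (α : Linf) (hα : ‖α‖ < (1 - 4 * ε) / 3) :
    ∃ β : Linf, ‖β‖ < (1 - ε) / 3 ∧ S β = α ∧
      (∀ γ : Linf, ‖γ‖ < (1 - ε) / 3 → S γ = α → γ = β) ∧
      ∀ n : ℕ, ‖(fun γ => α - (S γ - γ))^[n] 0‖ < (1 - ε) / 3 ∧
        ‖(fun γ => α - (S γ - γ))^[n] 0 - β‖ ≤ (6 * ε / (2 + ε)) ^ n := by
  have hε0 : 0 < ε := lt_of_le_of_lt (norm_nonneg _) (hc 0 (by simp))
  have hε : 4 * ε < 1 := by linarith [norm_nonneg α]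
  set k : ℝ := 6 * ε / (2 + ε) with hk
  have hk0 : 0 ≤ k := by positivity
  have hk1 : k < 1 := by rw [hk, div_lt_one (by linarith)]; linarith
  set Φ : Linf → Linf := fun γ => α - (S γ - γ) with hΦ
  have hΦb : ∀ γ : Linf, ‖γ‖ < 1 → ‖Φ γ‖ ≤ ‖α‖ + ε := by
    intro γ hγ
    have h1 := norm_sub_le α (S γ - γ)
    have h2 := hc γ (by simpa using hγ)
    simp only [hΦ]
    linarith
  have hΦc : ∀ x y : Linf, ‖x‖ < (1 - ε) / 3 → ‖y‖ < (1 - ε) / 3 →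
      ‖Φ x - Φ y‖ ≤ k * ‖x - y‖ := by
    intro x y hx hy
    have := linf_contract ε S hε hS hc x y hx hy
    rw [norm_sub_rev x y]
    convert this using 2
    simp only [hΦ]; abel
  have hmaps : Set.MapsTo Φ (Metric.closedBall 0 (‖α‖ + ε)) (Metric.closedBall 0 (‖α‖ + ε)) := by
    intro γ hγ
    rw [mem_closedBall_zero_iff] at hγ ⊢
    exact hΦb γ (by linarith)
  have hcontr : ContractingWith ⟨k, hk0⟩ (hmaps.restrict Φ _ _) := by
    refine ⟨by exact_mod_cast hk1, LipschitzWith.of_dist_le_mul ?_⟩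
    rintro ⟨x, hx⟩ ⟨y, hy⟩
    rw [mem_closedBall_zero_iff] at hx hy
    have := hΦc x y (by linarith) (by linarith)
    rw [Subtype.dist_eq, Subtype.dist_eq, dist_eq_norm, dist_eq_norm]
    exact this
  obtain ⟨β, hβ, hfix, -⟩ := hcontr.exists_fixedPoint' Metric.isClosed_closedBall.isComplete hmaps
    (x := 0) (by simp; positivity) (edist_ne_top _ _)
  rw [mem_closedBall_zero_iff] at hβ
  have hβ' : ‖β‖ < (1 - ε) / 3 := by linarith
  have hfix' : Φ β = β := hfix
  refine ⟨β, hβ', ?_, ?_, ?_⟩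
  · have : α - (S β - β) = β := hfix
    have h2 : S β = α - (α - (S β - β)) + β := by abel
    rw [h2, this]; abel
  · intro γ hγ hSγ
    have h1 : Φ γ = γ := by simp [hΦ, hSγ]
    have h2 := hΦc γ β hγ hβ'
    rw [h1, hfix'] at h2
    have h3 : ‖γ - β‖ = 0 := by nlinarith [norm_nonneg (γ - β)]
    exact sub_eq_zero.mp (norm_eq_zero.mp h3)
  · intro n
    induction n with
    | zero =>
      refine ⟨by simp; linarith, ?_⟩
      simp; linarith
    | succ n ih =>
      rw [Function.iterate_succ_apply']
      refine ⟨lt_of_le_of_lt (hΦb _ (by linarith [ih.1])) (by linarith), ?_⟩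
      have h := hΦc _ β ih.1 hβ'
      rw [hfix'] at h
      rw [pow_succ']
      exact h.trans (mul_le_mul_of_nonneg_left ih.2 hk0)

theorem linf_fam (ε : ℝ) (E : Type) [NormedAddCommGroup E] [NormedSpace ℂ E]
    (𝒰 : Set E) (Tfam : E → Linf → Linf)
    (hT : ∀ (Ω : Set ℂ), IsOpen Ω → ∀ (u : ℂ → E) (b : ℂ → Linf),
          AnalyticOnNhd ℂ u Ω → (∀ τ ∈ Ω, u τ ∈ 𝒰) →
          (∀ τ ∈ Ω, b τ ∈ Metric.ball (0 : Linf) 1) → CoordAnalytic Ω b →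
          ∀ j : ℕ, AnalyticOnNhd ℂ (fun τ => Tfam (u τ) (b τ) j) Ω)
    (hc : ∀ u ∈ 𝒰, ∀ β ∈ Metric.ball (0 : Linf) 1, ‖Tfam u β - β‖ < ε) :
    ∃ solfam : E → Linf → Linf,
          (∀ u ∈ 𝒰, ∀ α : Linf, ‖α‖ < (1 - 4 * ε) / 3 →
            ‖solfam u α‖ < (1 - ε) / 3 ∧ Tfam u (solfam u α) = α ∧
            ∀ β : Linf, ‖β‖ < (1 - ε) / 3 → Tfam u β = α → β = solfam u α) ∧
          (∀ (Ω : Set ℂ), IsOpen Ω → ∀ (u : ℂ → E) (a : ℂ → Linf),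
            AnalyticOnNhd ℂ u Ω → (∀ τ ∈ Ω, u τ ∈ 𝒰) →
            CoordAnalytic Ω a → (∀ τ ∈ Ω, ‖a τ‖ < (1 - 4 * ε) / 3) →
            ∀ j : ℕ, AnalyticOnNhd ℂ (fun τ => solfam (u τ) (a τ) j) Ω) := by
  have hS : ∀ u ∈ 𝒰, SeqAnalyticOn (Metric.ball 0 1) (Tfam u) := by
    intro u hu Ω hΩ b hb hba j
    exact hT Ω hΩ (fun _ => u) b (fun _ _ => analyticAt_const) (fun _ _ => hu) hb hba j
  have hex := fun u (hu : u ∈ 𝒰) => linf_sol ε (Tfam u) (hS u hu) (hc u hu)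
  choose! sol hsol1 hsol2 hsol3 hsol4 using hex
  refine ⟨sol, fun u hu α hα => ⟨hsol1 u hu α hα, hsol2 u hu α hα, hsol3 u hu α hα⟩, ?_⟩
  intro Ω hΩ u a hu hu𝒰 ha haρ j
  rcases Ω.eq_empty_or_nonempty with rfl | ⟨τ₀, hτ₀⟩
  · intro τ hτ; exact hτ.elim
  have hε0 : 0 < ε := lt_of_le_of_lt (norm_nonneg _) (hc _ (hu𝒰 τ₀ hτ₀) 0 (by simp))
  have hε : 4 * ε < 1 := by linarith [norm_nonneg (a τ₀), haρ τ₀ hτ₀]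
  set k : ℝ := 6 * ε / (2 + ε) with hk
  have hk0 : 0 ≤ k := by positivity
  have hk1 : k < 1 := by rw [hk, div_lt_one (by linarith)]; linarith
  set b : ℕ → ℂ → Linf := fun n τ => (fun γ => a τ - (Tfam (u τ) γ - γ))^[n] 0 with hb
  have hbn : ∀ n, ∀ τ ∈ Ω, ‖b n τ‖ < (1 - ε) / 3 ∧ ‖b n τ - sol (u τ) (a τ)‖ ≤ k ^ n :=
    fun n τ hτ => hsol4 (u τ) (hu𝒰 τ hτ) (a τ) (haρ τ hτ) n
  have hban : ∀ n, CoordAnalytic Ω (b n) := by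
    intro n
    induction n with
    | zero => intro i; simpa [hb] using analyticOnNhd_const
    | succ n ih =>
      intro i
      have h1 := hT Ω hΩ u (b n) hu hu𝒰
        (fun τ hτ => by rw [mem_ball_zero_iff]; linarith [(hbn n τ hτ).1]) ih i
      have : (fun τ => b (n + 1) τ i) = fun τ => a τ i - (Tfam (u τ) (b n τ) i - b n τ i) := by
        funext τ
        simp only [hb, Function.iterate_succ_apply']
        rfl
      rw [this]
      exact (ha i).sub (h1.sub (ih i))
  refine DifferentiableOn.analyticOnNhd ?_ hΩ
  have hunif : TendstoUniformlyOn (fun n τ => b n τ j) (fun τ => sol (u τ) (a τ) j)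
      Filter.atTop Ω := by
    rw [Metric.tendstoUniformlyOn_iff]
    intro δ hδ
    have := (tendsto_pow_atTop_nhds_zero_of_lt_one hk0 hk1).eventually (gt_mem_nhds hδ)
    filter_upwards [this] with n hn τ hτ
    rw [dist_comm, dist_eq_norm]
    have h1 := lp.norm_apply_le_norm (by simp) (b n τ - sol (u τ) (a τ)) j
    exact lt_of_le_of_lt (h1.trans (hbn n τ hτ).2) hn
  exact hunif.tendstoLocallyUniformlyOn.differentiableOn
    (Filter.Eventually.of_forall fun n => (hban n j).differentiableOn) hΩ

/-- **Lemma (Picard iteration in `ℓ∞`).** -/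
theorem linf_picard (ε : ℝ) (T : Linf → Linf)
    (hTanalytic : SeqAnalyticOn (Metric.ball 0 1) T)
    (hTclose : ∀ β ∈ Metric.ball (0 : Linf) 1, ‖T β - β‖ < ε) :
    -- existence, uniqueness, and analytic dependence on `α` of the solution `β*`
    (∃ sol : Linf → Linf,
      (∀ α : Linf, ‖α‖ < (1 - 4 * ε) / 3 →
        ‖sol α‖ < (1 - ε) / 3 ∧ T (sol α) = α ∧
        ∀ β : Linf, ‖β‖ < (1 - ε) / 3 → T β = α → β = sol α) ∧
      SeqAnalyticOn (Metric.ball 0 ((1 - 4 * ε) / 3)) sol) ∧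
    -- analytic dependence on an additional Banach-space parameter `u ∈ 𝒰`
    (∀ (E : Type) (_ : NormedAddCommGroup E) (_ : NormedSpace ℂ E)
        (𝒰 : Set E), IsOpen 𝒰 →
      ∀ Tfam : E → Linf → Linf,
        -- `T_u(β)_j` is analytic in `u` and `β`
        (∀ (Ω : Set ℂ), IsOpen Ω → ∀ (u : ℂ → E) (b : ℂ → Linf),
          AnalyticOnNhd ℂ u Ω → (∀ τ ∈ Ω, u τ ∈ 𝒰) →
          (∀ τ ∈ Ω, b τ ∈ Metric.ball (0 : Linf) 1) → CoordAnalytic Ω b →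
          ∀ j : ℕ, AnalyticOnNhd ℂ (fun τ => Tfam (u τ) (b τ) j) Ω) →
        (∀ u ∈ 𝒰, ∀ β ∈ Metric.ball (0 : Linf) 1, ‖Tfam u β - β‖ < ε) →
        ∃ solfam : E → Linf → Linf,
          (∀ u ∈ 𝒰, ∀ α : Linf, ‖α‖ < (1 - 4 * ε) / 3 →
            ‖solfam u α‖ < (1 - ε) / 3 ∧ Tfam u (solfam u α) = α ∧
            ∀ β : Linf, ‖β‖ < (1 - ε) / 3 → Tfam u β = α → β = solfam u α) ∧
          -- joint analytic dependence on `(u, α)`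
          (∀ (Ω : Set ℂ), IsOpen Ω → ∀ (u : ℂ → E) (a : ℂ → Linf),
            AnalyticOnNhd ℂ u Ω → (∀ τ ∈ Ω, u τ ∈ 𝒰) →
            CoordAnalytic Ω a → (∀ τ ∈ Ω, ‖a τ‖ < (1 - 4 * ε) / 3) →
            ∀ j : ℕ, AnalyticOnNhd ℂ (fun τ => solfam (u τ) (a τ) j) Ω)) := by
  refine ⟨?_, fun E _ _ 𝒰 _ Tfam hT hc => linf_fam ε E 𝒰 Tfam hT hc⟩
  obtain ⟨sol, h1, h2⟩ := linf_fam ε ℂ Set.univ (fun _ => T)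
    (fun Ω hΩ _ b _ _ hb hba j => hTanalytic Ω hΩ b hb hba j) (fun _ _ => hTclose)
  refine ⟨sol 0, fun α hα => h1 0 trivial α hα, ?_⟩
  intro Ω hΩ b hb hba j
  exact h2 Ω hΩ (fun _ => 0) b (fun _ _ => analyticAt_const) (fun _ _ => trivial) hba
    (fun τ hτ => by simpa using hb τ hτ) j
end
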